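/- Let r ≥ 2 and t ≥ s ≥ 1 be integers with t ≤ s + 1/2 + √(2s + 1/4). For every ε with 0 < ε < (r−1)/r there exist ξ > 0 and n₀ such that for all n ≥ n₀: F_{r,s,t}(⌊(r−1)n/r⌋, n) − F_{r,s,t}(⌊((r−1)/r − ε)n⌋, n) > ξ·n^{(r−1)s+t−1}. -/

import Mathlib

open SimpleGraph

/-- The number of copies of `T` in `G`, i.e. the number of subgraphs of `G` isomorphic to `T`. -/
noncomputable def copies {α β : Type*} (T : SimpleGraph α) (G : SimpleGraph β) : ℕ :=
  Nat.card {H : G.Subgraph // Nonempty (H.coe ≃g T)}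

/-- `G` contains no subgraph isomorphic to `T`. -/
def Free {α β : Type*} (T : SimpleGraph α) (G : SimpleGraph β) : Prop :=
  ∀ H : G.Subgraph, ¬ Nonempty (H.coe ≃g T)

/-- `K^{(r)}_{s,t}`: the complete `r`-partite graph with one part of size `t`
and the other `r-1` parts of size `s`. -/
noncomputable def Kmulti (r s t : ℕ) :
    SimpleGraph (Σ i : Fin r, Fin (if (i : ℕ) = 0 then t else s)) :=
  completeMultipartiteGraph _

/-- `F_{r,s,t}(a, n) = λ_{s,t}·[ C(n−1−a, s−1)·N(T_{r−1}(a), K^{(r−1)}_{s,t})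
      + C(n−1−a, t−1)·N(T_{r−1}(a), K^{(r−1)}_{s,s}) ]`. -/
noncomputable def Fval (r s t a n : ℕ) : ℝ :=
  (if s = t then (1 / 2 : ℝ) else 1) *
    (((n - 1 - a).choose (s - 1) : ℝ) * (copies (Kmulti (r - 1) s t) (turanGraph a (r - 1)) : ℝ)
      + ((n - 1 - a).choose (t - 1) : ℝ) * (copies (Kmulti (r - 1) s s) (turanGraph a (r - 1)) : ℝ))

open Filter Topology

theorem two_mul_one_sub_pow_le (u : ℝ) (h0 : 0 ≤ u) (h1 : u ≤ 1) (d : ℕ) :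
    2 * (1 - u ^ d) ≤ (1 - u) * ((d + 1) + (d - 1) * u ^ d) := by
  have hA : ∀ d : ℕ, 0 ≤ 1 + d * u ^ (d + 1) - (d + 1) * u ^ d := by
    intro d
    induction d with
    | zero => simp
    | succ d ih =>
      have : 0 ≤ (d + 1) * (u ^ d * (u - 1) ^ 2) := by positivity
      push_cast
      ring_nf at this ih ⊢
      linarith
  induction d with
  | zero => simp
  | succ d ih =>
    have := mul_nonneg (sub_nonneg.2 h1) (hA d)
    push_cast
    ring_nf at this ih ⊢
    linarith

theorem derivative_factor_pos (s u : ℝ) (d : ℕ) (hs : 1 ≤ s) (hd : (d : ℝ) * (d - 1) ≤ 2 * s)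
    (h0 : 0 < u) (h1 : u < 1) :
    0 < s * (s + d) * u ^ d - s * (s - 1) * u ^ (d + 1) + s * (s + d)
      - (s + d) * (s + d - 1) * u := by
  rcases d with _ | _ | d
  · simp
    nlinarith [mul_nonneg (mul_nonneg (by linarith : (0 : ℝ) ≤ s) (by linarith : 0 ≤ s - 1))
      (sub_pos.2 h1).le]
  · simp
    have : s * (s - 1) * u ^ 2 ≤ s * (s - 1) := by
      apply mul_le_of_le_one_right
      · nlinarith
      · nlinarith
    nlinarith
  · have key := two_mul_one_sub_pow_le u h0.le h1.le (d + 1 + 1)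
    have hv0 : 0 < u ^ (d + 1 + 1) := by positivity
    have hv1 : u ^ (d + 1 + 1) < 1 := pow_lt_one₀ h0.le h1 (by omega)
    rw [pow_succ u (d + 1 + 1)]
    have hD : (2 : ℝ) ≤ ((d + 1 + 1 : ℕ) : ℝ) := by exact_mod_cast (by omega : 2 ≤ d + 1 + 1)
    generalize u ^ (d + 1 + 1) = v at *
    generalize ((d + 1 + 1 : ℕ) : ℝ) = D at *
    have hE1 : 0 ≤ (s - 1) * (2 * s - D * (D - 1)) :=
      mul_nonneg (by linarith) (by linarith)
    have hE0 : 0 < s * (2 * s - D * (D - 1)) / 2 + s * (D - 3) / 2 + D * (D - 1) := by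
      nlinarith [mul_nonneg (by linarith : (0 : ℝ) ≤ s) (by linarith : 0 ≤ 2 * s - D * (D - 1)),
        mul_nonneg (by linarith : (0 : ℝ) ≤ s) (by linarith : 0 ≤ D - 2)]
    have hX := mul_pos (sub_pos.2 h1) (add_pos_of_pos_of_nonneg
      (mul_pos (sub_pos.2 hv1) hE0) (mul_nonneg hv0.le hE1))
    have hK := mul_le_mul_of_nonneg_left key (by nlinarith : 0 ≤ s * (D + 1) / 2)
    nlinarith

theorem profile_strictMonoOn (k p d : ℕ) (hk : 1 ≤ k)
    (hd : (d : ℝ) * (d - 1) ≤ 2 * (p + 1)) :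
    StrictMonoOn (fun m : ℝ => m ^ (k * (p + 1)) * (1 - k * m) ^ p *
      (k * (p + 1) * m ^ d + (p + 1 + d) * (1 - k * m) ^ d)) (Set.Icc 0 (1 / (k + 1))) := by
  apply strictMonoOn_of_deriv_pos (convex_Icc _ _)
  · fun_prop
  intro m hm
  rw [interior_Icc] at hm
  obtain ⟨hm0, hm1⟩ := hm
  have hkR : (1 : ℝ) ≤ k := by exact_mod_cast hk
  have hmy : m < 1 - k * m := by
    rw [lt_div_iff₀ (by positivity)] at hm1
    linarith
  have hy0 : 0 < 1 - k * m := hm0.trans hmy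
  have hy : HasDerivAt (fun m : ℝ => 1 - k * m) (-k) m := by
    simpa using ((hasDerivAt_id m).const_mul (k : ℝ)).const_sub 1
  have hder := ((hasDerivAt_pow (k * (p + 1)) m).mul (hy.pow p)).mul
    (((hasDerivAt_pow d m).const_mul ((k : ℝ) * (p + 1))).add
      ((hy.pow d).const_mul ((p : ℝ) + 1 + d)))
  have hder' := hder.deriv
  simp only [Pi.mul_def, Pi.add_def, Pi.pow_def] at hder'
  rw [hder']
  generalize 1 - k * m = y at *
  have e1 : ∀ (n : ℕ) (x : ℝ), (n : ℝ) * x ^ (n - 1) * x = n * x ^ n := by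
    intro n x
    cases n with
    | zero => simp
    | succ n => simp [pow_succ]; ring
  have e := e1 (k * (p + 1)) m
  have ep := e1 p y
  have edm := e1 d m
  have edy := e1 d y
  have hu := derivative_factor_pos (p + 1) (m / y) d (by linarith [p.cast_nonneg (α := ℝ)]) hd
    (div_pos hm0 hy0) ((div_lt_one hy0).2 hmy)
  have hh := mul_pos hu (pow_pos hy0 (d + 1))
  have hG : 0 < ((p + 1) * y - p * m) * (k * (p + 1) * m ^ d + (p + 1 + d) * y ^ d)
      + (p + 1) * d * m ^ d * y - (p + 1 + d) * d * m * y ^ d := by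
    have e5 : (m / y) * y = m := div_mul_cancel₀ _ hy0.ne'
    have hb : 0 ≤ (k - 1) * ((p + 1) * m ^ d * ((p + 1) * y - p * m)) := by
      have : 0 ≤ (p + 1) * y - p * m := by nlinarith [p.cast_nonneg (α := ℝ)]
      have : (0 : ℝ) ≤ k - 1 := by linarith
      positivity
    have : 0 < (p + 1) * (p + 1 + d) * m ^ d * y - (p + 1) * (p + 1 - 1) * m ^ (d + 1)
        + (p + 1) * (p + 1 + d) * y ^ (d + 1) - (p + 1 + d) * (p + 1 + d - 1) * m * y ^ d := by
      refine hh.trans_eq ?_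
      generalize m / y = u at e5
      rw [← e5, mul_pow, mul_pow]
      ring
    ring_nf at this hb ⊢
    linarith
  have hP : 0 < k * (m ^ (k * (p + 1)) * y ^ p) *
      (((p + 1) * y - p * m) * (k * (p + 1) * m ^ d + (p + 1 + d) * y ^ d)
      + (p + 1) * d * m ^ d * y - (p + 1 + d) * d * m * y ^ d) := by positivity
  refine pos_of_mul_pos_left (b := m * y) ?_ (by positivity)
  refine hP.trans_eq ?_
  push_cast at e ⊢
  generalize m ^ (k * (p + 1) - 1) = a1 at *
  generalize m ^ (k * (p + 1)) = a0 at *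
  generalize y ^ (p - 1) = b1 at *
  generalize y ^ p = b0 at *
  generalize m ^ (d - 1) = c1 at *
  generalize y ^ (d - 1) = f1 at *
  linear_combination (-(b0 * (k * (p + 1) * m ^ d + (p + 1 + d) * y ^ d) * y)) * e
    + (a0 * k * (k * (p + 1) * m ^ d + (p + 1 + d) * y ^ d) * m) * ep
    - a0 * b0 * (k * (p + 1)) * y * edm + a0 * b0 * (p + 1 + d) * k * m * edy

theorem tendsto_natSub_div {b : ℕ → ℕ} {β : ℝ}
    (hb : Tendsto (fun n => (b n : ℝ) / n) atTop (𝓝 β)) (i : ℕ) :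
    Tendsto (fun n => ((b n - i : ℕ) : ℝ) / n) atTop (𝓝 β) := by
  have h0 : Tendsto (fun n : ℕ => (i : ℝ) / n) atTop (𝓝 0) :=
    tendsto_const_div_atTop_nhds_zero_nat _
  have h1 := hb.sub h0
  rw [sub_zero] at h1
  refine tendsto_of_tendsto_of_tendsto_of_le_of_le h1 hb (fun n => ?_) (fun n => ?_)
  · simp only [← sub_div]
    gcongr
    rw [sub_le_iff_le_add]
    exact_mod_cast (by omega : b n ≤ b n - i + i)
  · simp only
    gcongr
    exact Nat.sub_le _ _

theorem tendsto_choose_div {b : ℕ → ℕ} {β : ℝ}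
    (hb : Tendsto (fun n => (b n : ℝ) / n) atTop (𝓝 β)) (j : ℕ) :
    Tendsto (fun n => ((b n).choose j : ℝ) / (n : ℝ) ^ j) atTop (𝓝 (β ^ j / j.factorial)) := by
  have h := (tendsto_finsetProd (Finset.range j)
    (fun i _ => tendsto_natSub_div hb i)).div_const (j.factorial : ℝ)
  simp only [Finset.prod_const, Finset.card_range] at h
  refine h.congr fun n => ?_
  rw [Finset.prod_div_distrib, Finset.prod_const, Finset.card_range, ← Nat.cast_prod,
    ← Nat.descFactorial_eq_prod_range, Nat.descFactorial_eq_factorial_mul_choose]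
  have : (j.factorial : ℝ) ≠ 0 := by positivity
  push_cast
  field_simp

open Finset in
theorem card_profile {α ι : Type*} [Fintype α] [DecidableEq α] [Fintype ι] [DecidableEq ι]
    (col : α → ι) (c : ι → ℕ) :
    #{W : Finset α | ∀ i, #{v ∈ W | col v = i} = c i} =
      ∏ i, (#{v : α | col v = i}).choose (c i) := by
  have : ∏ i, (#{v : α | col v = i}).choose (c i) =
      #(Fintype.piFinset fun i => powersetCard (c i) ({v : α | col v = i} : Finset α)) := by
    rw [Fintype.card_piFinset]
    simp
  rw [this]
  refine Finset.card_bij' (fun W _ i => {v ∈ W | col v = i})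
    (fun f _ => ({v : α | v ∈ f (col v)} : Finset α))
    ?_ ?_ ?_ ?_
  · intro W hW
    simp only [mem_filter, mem_univ, true_and] at hW
    simp only [Fintype.mem_piFinset, mem_powersetCard]
    exact fun i => ⟨fun v hv => by simp_all, hW i⟩
  · intro f hf
    simp only [Fintype.mem_piFinset, mem_powersetCard] at hf
    simp only [mem_filter, mem_univ, true_and]
    intro i
    rw [← (hf i).2]
    congr 1
    ext v
    have := @(hf i).1 v
    simp only [mem_filter, mem_univ, true_and] at this ⊢
    grind
  · intro W hW
    ext v
    simp
  · intro f hf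
    simp only [Fintype.mem_piFinset, mem_powersetCard] at hf
    ext i v
    have := @(hf i).1 v
    simp only [mem_filter, mem_univ, true_and] at this ⊢
    grind

theorem exists_perm_of_iso {α : Type*} {k : ℕ} {b : Fin k → ℕ}
    (hb : ∀ i, 0 < b i) {G : SimpleGraph α} {col : α → Fin k}
    (hG : ∀ v w, G.Adj v w ↔ col v ≠ col w) {H : G.Subgraph}
    (e : H.coe ≃g completeMultipartiteGraph fun i => Fin (b i)) :
    ∃ σ : Equiv.Perm (Fin k), ∀ v, col (e.symm v) = σ v.1 := by
  have hadj : ∀ x y : (Σ i, Fin (b i)), x.1 ≠ y.1 → col (e.symm x) ≠ col (e.symm y) := by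
    intro x y hxy
    have h : (completeMultipartiteGraph fun i => Fin (b i)).Adj x y := hxy
    rw [← e.symm.map_adj_iff] at h
    exact (hG _ _).1 h.adj_sub
  let σ : Fin k → Fin k := fun i => col (e.symm ⟨i, ⟨0, hb i⟩⟩)
  have hσ : Function.Injective σ := by
    intro i j hij
    by_contra hne
    exact hadj ⟨i, ⟨0, hb i⟩⟩ ⟨j, ⟨0, hb j⟩⟩ hne hij
  have hbij := Finite.injective_iff_bijective.1 hσ
  refine ⟨Equiv.ofBijective σ hbij, fun v => ?_⟩
  obtain ⟨j, hj⟩ := hbij.2 (col (e.symm v))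
  by_cases hjv : v.1 = j
  · rw [← hj, hjv]; rfl
  · exact absurd hj.symm (hadj v ⟨j, ⟨0, hb j⟩⟩ hjv)

theorem card_fiber_of_iso {α : Type*} [DecidableEq α] {k : ℕ} {b : Fin k → ℕ}
    {G : SimpleGraph α} {col : α → Fin k} {H : G.Subgraph}
    (e : H.coe ≃g completeMultipartiteGraph fun i => Fin (b i)) {σ : Equiv.Perm (Fin k)}
    (hσ : ∀ v, col (e.symm v) = σ v.1) {W : Finset α} (hW : (W : Set α) = H.verts) (j : Fin k) :
    (W.filter (col · = σ j)).card = b j := by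
  have : (W.filter (col · = σ j)) =
      Finset.univ.map ⟨fun x : Fin (b j) => (e.symm ⟨j, x⟩ : α), fun x y hxy => by
        simpa using e.symm.injective (Subtype.ext hxy)⟩ := by
    ext v
    simp only [Finset.mem_filter, Finset.mem_map, Finset.mem_univ, true_and]
    constructor
    · rintro ⟨hv, hc⟩
      have hv' : v ∈ H.verts := by rw [← hW]; exact hv
      have h1 := hσ (e ⟨v, hv'⟩)
      rw [e.symm_apply_apply] at h1
      have h2 : j = (e ⟨v, hv'⟩).1 := σ.injective (hc.symm.trans h1)
      subst h2
      exact ⟨(e ⟨v, hv'⟩).2, congrArg Subtype.val (e.symm_apply_apply ⟨v, hv'⟩)⟩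
    · rintro ⟨x, rfl⟩
      refine ⟨?_, hσ _⟩
      rw [← Finset.mem_coe, hW]
      exact (e.symm ⟨j, x⟩).2
  rw [this]
  simp

theorem adj_iff_of_iso {α : Type*} {k : ℕ} {b : Fin k → ℕ}
    {G : SimpleGraph α} {col : α → Fin k} {H : G.Subgraph}
    (e : H.coe ≃g completeMultipartiteGraph fun i => Fin (b i)) {σ : Equiv.Perm (Fin k)}
    (hσ : ∀ v, col (e.symm v) = σ v.1) (v w : α) :
    H.Adj v w ↔ v ∈ H.verts ∧ w ∈ H.verts ∧ col v ≠ col w := by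
  have key : ∀ (hv : v ∈ H.verts) (hw : w ∈ H.verts), H.Adj v w ↔ col v ≠ col w := by
    intro hv hw
    have h1 := hσ (e ⟨v, hv⟩)
    have h2 := hσ (e ⟨w, hw⟩)
    rw [e.symm_apply_apply] at h1 h2
    have h3 : H.coe.Adj ⟨v, hv⟩ ⟨w, hw⟩ ↔ (e ⟨v, hv⟩).1 ≠ (e ⟨w, hw⟩).1 :=
      e.map_adj_iff.symm
    rw [show H.Adj v w ↔ _ from h3]
    simp only at h1 h2
    rw [h1, h2, σ.injective.ne_iff]
  constructor
  · intro h
    exact ⟨h.fst_mem, h.snd_mem, (key h.fst_mem h.snd_mem).1 h⟩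
  · rintro ⟨hv, hw, h⟩
    exact (key hv hw).2 h

theorem nonempty_iso_induce {α : Type*} [DecidableEq α] {k : ℕ} {b : Fin k → ℕ}
    {G : SimpleGraph α} {col : α → Fin k} (hG : ∀ v w, G.Adj v w ↔ col v ≠ col w)
    {W : Finset α} (σ : Equiv.Perm (Fin k))
    (hσ : ∀ j, (W.filter (col · = σ j)).card = b j) :
    Nonempty (((⊤ : G.Subgraph).induce (W : Set α)).coe ≃g
      completeMultipartiteGraph fun i => Fin (b i)) := by
  let f : W → Fin k := fun v => σ.symm (col v)
  have hcard : ∀ j, Nonempty ({v : W // f v = j} ≃ Fin (b j)) := by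
    intro j
    refine ⟨Fintype.equivFinOfCardEq ?_⟩
    rw [← hσ j, ← Fintype.card_coe]
    refine Fintype.card_congr ⟨fun v => ⟨v.1.1, ?_⟩, fun v => ⟨⟨v.1, ?_⟩, ?_⟩, ?_, ?_⟩
    · have := v.2
      simp only [f, Equiv.symm_apply_eq] at this
      simp [this]
    · exact (Finset.mem_filter.1 v.2).1
    · simp only [f, Equiv.symm_apply_eq]
      exact (Finset.mem_filter.1 v.2).2
    · intro v; rfl
    · intro v; rfl
  let E : W ≃ Σ i, Fin (b i) :=
    (Equiv.sigmaFiberEquiv f).symm.trans (Equiv.sigmaCongrRight fun j => (hcard j).some)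
  refine ⟨⟨E, fun {v w} => ?_⟩⟩
  have hv : v.1 ∈ W := v.2
  have hw : w.1 ∈ W := w.2
  change σ.symm (col v) ≠ σ.symm (col w) ↔ v.1 ∈ (W : Set α) ∧ w.1 ∈ (W : Set α) ∧ G.Adj v.1 w.1
  rw [σ.symm.injective.ne_iff, hG]
  exact ⟨fun h => ⟨hv, hw, h⟩, fun h => h.2.2⟩

theorem copies_completeMultipartite {α : Type*} [Fintype α] [DecidableEq α] {k : ℕ} {b : Fin k → ℕ}
    (hb : ∀ i, 0 < b i) {G : SimpleGraph α} {col : α → Fin k}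
    (hG : ∀ v w, G.Adj v w ↔ col v ≠ col w) :
    copies (completeMultipartiteGraph fun i => Fin (b i)) G =
      Nat.card {W : Finset α // ∃ σ : Equiv.Perm (Fin k),
        ∀ j, (W.filter (col · = σ j)).card = b j} := by
  classical
  refine Nat.card_eq_of_bijective (fun H => ⟨H.1.verts.toFinset, ?_⟩) ⟨?_, ?_⟩
  · obtain ⟨H, ⟨e⟩⟩ := H
    obtain ⟨σ, hσ⟩ := exists_perm_of_iso hb hG e
    exact ⟨σ, card_fiber_of_iso e hσ (by simp)⟩
  · rintro ⟨H, ⟨e⟩⟩ ⟨H', ⟨e'⟩⟩ h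
    have hV : H.verts = H'.verts := by simpa using h
    obtain ⟨σ, hσ⟩ := exists_perm_of_iso hb hG e
    obtain ⟨σ', hσ'⟩ := exists_perm_of_iso hb hG e'
    refine Subtype.ext (Subgraph.ext hV ?_)
    ext v w
    rw [adj_iff_of_iso e hσ, adj_iff_of_iso e' hσ', hV]
  · rintro ⟨W, σ, hσ⟩
    exact ⟨⟨_, nonempty_iso_induce hG σ hσ⟩, by simp⟩

theorem exists_perm_profile_iff {k s t : ℕ} (hk : 0 < k) (c : Fin k → ℕ) :
    (∃ σ : Equiv.Perm (Fin k), ∀ j, c (σ j) = if (j : ℕ) = 0 then t else s) ↔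
      ∃ i, Function.update (fun _ => s) i t = c := by
  have : NeZero k := ⟨hk.ne'⟩
  constructor
  · rintro ⟨σ, h⟩
    refine ⟨σ 0, ?_⟩
    ext j
    obtain ⟨j, rfl⟩ := σ.surjective j
    rw [h, Function.update_apply]
    simp only [σ.injective.eq_iff, Fin.ext_iff, Fin.val_zero]
  · rintro ⟨i, rfl⟩
    refine ⟨Equiv.swap 0 i, fun j => ?_⟩
    rw [Function.update_apply]
    refine if_congr ?_ rfl rfl
    rw [Equiv.swap_apply_eq_iff, Equiv.swap_apply_right, Fin.ext_iff, Fin.val_zero]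

theorem copies_Kmulti_turanGraph {k s t : ℕ} (hk : 0 < k) (hs : 0 < s) (ht : 0 < t) (a : ℕ) :
    copies (Kmulti k s t) (turanGraph a k) =
      ∑ c ∈ Finset.univ.image fun i : Fin k => Function.update (fun _ => s) i t,
        ∏ i : Fin k, (a.count (· ≡ (i : ℕ) [MOD k])).choose (c i) := by
  classical
  let col : Fin a → Fin k := fun v => ⟨v % k, Nat.mod_lt _ hk⟩
  have hG : ∀ v w, (turanGraph a k).Adj v w ↔ col v ≠ col w := by
    intro v w
    simp [turanGraph, col]
  have hcount : ∀ i : Fin k, (Finset.univ.filter (col · = i)).card =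
      a.count (· ≡ (i : ℕ) [MOD k]) := by
    intro i
    rw [Nat.count_eq_card_filter_range, ← Finset.card_map Fin.valEmbedding]
    congr 1
    ext v
    simp only [Finset.mem_map, Finset.mem_filter, Finset.mem_univ, true_and, Finset.mem_range,
      Fin.valEmbedding_apply, col, Fin.ext_iff, Nat.ModEq, Nat.mod_eq_of_lt i.2]
    exact ⟨by rintro ⟨x, hx, rfl⟩; exact ⟨x.2, hx⟩, fun h => ⟨⟨v, h.1⟩, h.2, rfl⟩⟩
  rw [Kmulti, copies_completeMultipartite (fun i => by split_ifs <;> assumption) hG,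
    Nat.card_eq_fintype_card, Fintype.card_subtype]
  have : (Finset.univ.filter fun W : Finset (Fin a) => ∃ σ : Equiv.Perm (Fin k),
      ∀ j, (W.filter (col · = σ j)).card = if (j : ℕ) = 0 then t else s) =
      (Finset.univ.image fun i : Fin k => Function.update (fun _ => s) i t).biUnion fun c =>
        Finset.univ.filter fun W : Finset (Fin a) => ∀ i, (W.filter (col · = i)).card = c i := by
    ext W
    have := exists_perm_profile_iff (s := s) (t := t) hk fun i => (W.filter (col · = i)).card
    simp only [Finset.mem_filter, Finset.mem_univ, true_and, Finset.mem_biUnion,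
      Finset.mem_image, this, exists_exists_eq_and]
    simp only [funext_iff, eq_comm]
  rw [this, Finset.card_biUnion]
  · refine Finset.sum_congr rfl fun c _ => ?_
    simp only [← hcount]
    convert card_profile col c
  · intro c _ c' _ hcc
    refine Finset.disjoint_left.2 fun W h h' => hcc ?_
    simp only [Finset.mem_filter, Finset.mem_univ, true_and] at h h'
    ext i
    rw [← h i, ← h' i]

theorem tendsto_count_modEq_div {k : ℕ} (hk : 0 < k) (i : ℕ) {a : ℕ → ℕ} {x : ℝ}
    (ha : Tendsto (fun n => (a n : ℝ) / n) atTop (𝓝 x)) :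
    Tendsto (fun n => ((a n).count (· ≡ i [MOD k]) : ℝ) / n) atTop (𝓝 (x / k)) := by
  have h0 : Tendsto (fun n : ℕ => (k : ℝ) / n) atTop (𝓝 0) :=
    tendsto_const_div_atTop_nhds_zero_nat _
  have hkR : (0 : ℝ) < k := by exact_mod_cast hk
  have h1 := (ha.sub h0).div_const (k : ℝ)
  have h2 := (ha.add h0).div_const (k : ℝ)
  rw [sub_zero] at h1
  rw [add_zero] at h2
  have hle (n : ℕ) : a n ≤ k * (a n).count (· ≡ i [MOD k]) + k ∧
      k * (a n).count (· ≡ i [MOD k]) ≤ a n + k := by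
    rw [Nat.count_modEq_card _ hk]
    have h3 := Nat.div_add_mod (a n) k
    have h4 := Nat.mod_lt (a n) hk
    split_ifs <;> constructor <;> simp only [mul_add, mul_one, mul_zero] <;> omega
  refine tendsto_of_tendsto_of_tendsto_of_le_of_le h1 h2 (fun n => ?_) (fun n => ?_)
  · simp only
    rw [← sub_div, div_right_comm]
    gcongr
    rw [div_le_iff₀ hkR, sub_le_iff_le_add, mul_comm]
    exact_mod_cast (hle n).1
  · simp only
    rw [← add_div, div_right_comm]
    gcongr
    rw [le_div_iff₀ hkR, mul_comm]
    exact_mod_cast (hle n).2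

theorem prod_comp_update_const {ι M : Type*} [Fintype ι] [DecidableEq ι] [CommMonoid M]
    (g : ℕ → M) (s t : ℕ) (i : ι) :
    ∏ j, g (Function.update (fun _ => s) i t j) = g t * g s ^ (Fintype.card ι - 1) := by
  rw [← Finset.mul_prod_erase Finset.univ _ (Finset.mem_univ i), Function.update_self,
    Finset.prod_congr rfl fun j hj => by
      rw [Function.update_of_ne (Finset.ne_of_mem_erase hj)],
    Finset.prod_const, Finset.card_erase_of_mem (Finset.mem_univ i), Finset.card_univ]

theorem tendsto_copies_Kmulti_turanGraph {k s t : ℕ} (hk : 0 < k) (hs : 0 < s) (ht : 0 < t)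
    {a : ℕ → ℕ} {x : ℝ} (ha : Tendsto (fun n => (a n : ℝ) / n) atTop (𝓝 x)) :
    Tendsto (fun n : ℕ => (copies (Kmulti k s t) (turanGraph (a n) k) : ℝ) /
        ((n : ℝ) ^ t * ((n : ℝ) ^ s) ^ (k - 1))) atTop
      (𝓝 ((if s = t then 1 else k : ℕ) *
        ((x / k) ^ t / t.factorial * ((x / k) ^ s / s.factorial) ^ (k - 1)))) := by
  have hcard : (Finset.univ.image fun i : Fin k => Function.update (fun _ => s) i t).card =
      if s = t then 1 else k := by
    split_ifs with h
    · have : NeZero k := ⟨hk.ne'⟩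
      subst h
      have h1 : (fun i : Fin k => Function.update (fun _ => s) i s) = fun _ _ => s := by
        ext i j
        simp
      rw [h1, Finset.image_const Finset.univ_nonempty, Finset.card_singleton]
    · rw [Finset.card_image_of_injective, Finset.card_univ, Fintype.card_fin]
      intro i j hij
      by_contra hne
      have := congrFun hij i
      simp only [Function.update_self, Function.update_of_ne hne] at this
      exact h this.symm
  rw [← hcard, ← nsmul_eq_mul, ← Finset.sum_const]
  simp only [copies_Kmulti_turanGraph hk hs ht, Nat.cast_sum, Finset.sum_div]
  refine tendsto_finsetSum _ fun c hc => ?_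
  obtain ⟨i, -, rfl⟩ := Finset.mem_image.1 hc
  have h := tendsto_finsetProd Finset.univ fun (j : Fin k) _ =>
    tendsto_choose_div (tendsto_count_modEq_div hk j ha)
      (Function.update (fun _ : Fin k => s) i t j)
  rw [prod_comp_update_const (fun e => (x / k) ^ e / e.factorial), Fintype.card_fin] at h
  refine h.congr fun n => ?_
  rw [Finset.prod_div_distrib, prod_comp_update_const (fun e => (n : ℝ) ^ e), Fintype.card_fin,
    Nat.cast_prod]

theorem tendsto_Fval {k p d : ℕ} (hk : 0 < k) {a : ℕ → ℕ} (han : ∀ n, a n ≤ n) {x : ℝ}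
    (ha : Tendsto (fun n => (a n : ℝ) / n) atTop (𝓝 x)) :
    Tendsto (fun n : ℕ => Fval (k + 1) (p + 1) (p + 1 + d) (a n) n /
        (n : ℝ) ^ (k * (p + 1) + (p + 1 + d) - 1)) atTop
      (𝓝 ((if d = 0 then 1 / ((k : ℝ) + 1) else 1) /
          ((p + 1 + d).factorial * ((p + 1).factorial : ℝ) ^ k) *
        ((x / k) ^ (k * (p + 1)) * (1 - k * (x / k)) ^ p *
          (k * (p + 1) * (x / k) ^ d + (p + 1 + d) * (1 - k * (x / k)) ^ d)))) := by
  have hsub : Tendsto (fun n => ((n - a n : ℕ) : ℝ) / n) atTop (𝓝 (1 - x)) := by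
    refine (ha.const_sub 1).congr' ?_
    filter_upwards [eventually_gt_atTop 0] with n hn
    have : (n : ℝ) ≠ 0 := by positivity
    rw [Nat.cast_sub (han n)]
    field_simp
  have hsub1 := tendsto_natSub_div hsub 1
  have h1 := (tendsto_choose_div hsub1 p).mul
    (tendsto_copies_Kmulti_turanGraph hk (s := p + 1) (t := p + 1 + d) (by omega) (by omega) ha)
  have h2 := (tendsto_choose_div hsub1 (p + d)).mul
    (tendsto_copies_Kmulti_turanGraph hk (s := p + 1) (t := p + 1) (by omega) (by omega) ha)
  have h3 := (h1.add h2).const_mul (if p + 1 = p + 1 + d then (1 / 2 : ℝ) else 1)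
  obtain ⟨j, rfl⟩ : ∃ j, k = j + 1 := ⟨k - 1, by omega⟩
  convert h3 using 1
  · ext n
    rw [Fval, mul_div_assoc]
    congr 1
    have e1 : (j + 1) * (p + 1) + (p + 1 + d) - 1 = p + ((p + 1 + d) + (p + 1) * j) := by
      ring_nf; omega
    have e2 : (j + 1) * (p + 1) + (p + 1 + d) - 1 = (p + d) + ((p + 1) + (p + 1) * j) := by
      ring_nf; omega
    have e3 : p + 1 + d - 1 = p + d := by omega
    rw [add_div]
    congr 1
    · rw [e1, pow_add, pow_add, pow_mul, mul_div_mul_comm, Nat.sub_right_comm]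
      simp
    · rw [e2, pow_add _ (p + d), pow_add _ (p + 1), pow_mul, mul_div_mul_comm,
        Nat.sub_right_comm, e3]
      simp
  · congr 1
    have e0 : 1 - ((j + 1 : ℕ) : ℝ) * (x / (j + 1 : ℕ)) = 1 - x := by
      rw [mul_div_cancel₀]
      positivity
    rw [e0]
    generalize x / ((j + 1 : ℕ) : ℝ) = m
    generalize 1 - x = y
    have hp : (p.factorial : ℝ) ≠ 0 := by positivity
    have hpd : ((p + d).factorial : ℝ) ≠ 0 := by positivity
    have f1 : (p + 1 + d).factorial = (p + d + 1) * (p + d).factorial := by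
      rw [show p + 1 + d = p + d + 1 by omega, Nat.factorial_succ]
    have em : m ^ ((j + 1) * (p + 1)) = m ^ (p + 1) * (m ^ (p + 1)) ^ j := by
      rw [mul_comm, pow_mul, pow_succ']
    rcases Nat.eq_zero_or_pos d with rfl | hd
    · rw [em]
      simp only [Nat.factorial_succ, Nat.add_sub_cancel, div_pow, add_zero, if_true]
      push_cast
      field_simp
      ring
    · rw [em, f1, if_neg hd.ne', if_neg (by omega), if_neg (by omega)]
      simp only [Nat.factorial_succ, Nat.add_sub_cancel, div_pow, if_true, pow_add m (p + 1) d,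
        pow_add y p d]
      push_cast
      field_simp
      ring

theorem statement17 (r s t : ℕ) (hr : 2 ≤ r) (hs : 1 ≤ s) (hst : s ≤ t)
    (ht : (t : ℝ) ≤ s + 1 / 2 + Real.sqrt (2 * s + 1 / 4)) :
    ∀ ε : ℝ, 0 < ε → ε < ((r : ℝ) - 1) / r →
      ∃ (ξ : ℝ) (n₀ : ℕ), 0 < ξ ∧ ∀ n ≥ n₀,
        ξ * (n : ℝ) ^ ((r - 1) * s + t - 1)
          < Fval r s t ((r - 1) * n / r) n
            - Fval r s t ⌊(((r : ℝ) - 1) / r - ε) * n⌋₊ n := by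
  intro ε hε hεr
  obtain ⟨k, rfl⟩ : ∃ k, r = k + 1 := ⟨r - 1, by omega⟩
  obtain ⟨p, rfl⟩ : ∃ p, s = p + 1 := ⟨s - 1, by omega⟩
  obtain ⟨d, rfl⟩ : ∃ d, t = p + 1 + d := ⟨t - (p + 1), by omega⟩
  have hk : 1 ≤ k := by omega
  have hkR : (1 : ℝ) ≤ k := by exact_mod_cast hk
  have hd : (d : ℝ) * (d - 1) ≤ 2 * (p + 1) := by
    push_cast at ht
    have h1 : (d : ℝ) - 1 / 2 ≤ Real.sqrt (2 * (p + 1) + 1 / 4) := by linarith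
    have h2 := Real.sq_sqrt (by positivity : (0 : ℝ) ≤ 2 * (p + 1) + 1 / 4)
    rcases Nat.eq_zero_or_pos d with rfl | hd
    · simp
      positivity
    · have h3 : (1 : ℝ) ≤ d := by exact_mod_cast hd
      nlinarith [pow_le_pow_left₀ (by linarith) h1 2]
  have hx : (((k + 1 : ℕ) : ℝ) - 1) / (k + 1 : ℕ) = k / (k + 1) := by
    push_cast
    ring
  rw [hx] at hεr ⊢
  have hx1 : (k : ℝ) / (k + 1) ≤ 1 := (div_le_one (by positivity)).2 (by linarith)
  have hfloor : ∀ x : ℝ, 0 ≤ x → Tendsto (fun n : ℕ => (⌊x * n⌋₊ : ℝ) / n) atTop (𝓝 x) :=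
    fun x h => (tendsto_nat_floor_mul_div_atTop h).comp tendsto_natCast_atTop_atTop
  have hle : ∀ x : ℝ, x ≤ 1 → ∀ n : ℕ, ⌊x * n⌋₊ ≤ n := fun x h n =>
    Nat.floor_le_of_le (mul_le_of_le_one_left n.cast_nonneg h)
  have hdiv : ∀ n : ℕ, (k + 1 - 1) * n / (k + 1) = ⌊(k : ℝ) / (k + 1) * n⌋₊ := by
    intro n
    rw [← Nat.floor_div_eq_div (K := ℝ)]
    rw [Nat.add_sub_cancel]
    push_cast
    rw [div_mul_eq_mul_div]
  simp only [hdiv]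
  have hlim := (tendsto_Fval (p := p) (d := d) hk (hle _ hx1) (hfloor _ (by positivity))).sub
    (tendsto_Fval (p := p) (d := d) hk (hle (k / (k + 1) - ε) (by linarith))
      (hfloor _ (by linarith)))
  have hmono := profile_strictMonoOn k p d hk hd
    (a := (k / (k + 1) - ε) / k) (b := k / (k + 1) / k)
    ⟨div_nonneg (by linarith) (by linarith), by
      rw [div_le_iff₀ (by linarith), one_div_mul_eq_div]; linarith⟩
    ⟨by positivity, by rw [div_le_iff₀ (by linarith), one_div_mul_eq_div]⟩
    (by gcongr; linarith)
  rw [← mul_sub] at hlim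
  have hpos := mul_pos (a := (if d = 0 then 1 / ((k : ℝ) + 1) else 1) /
      ((p + 1 + d).factorial * ((p + 1).factorial : ℝ) ^ k))
    (by split_ifs <;> positivity) (sub_pos.2 hmono)
  obtain ⟨ξ, hξ, hξL⟩ := exists_between hpos
  obtain ⟨n₀, hn₀⟩ :=
    eventually_atTop.1 ((hlim.eventually_const_lt hξL).and (eventually_gt_atTop 0))
  refine ⟨ξ, n₀, hξ, fun n hn => ?_⟩
  obtain ⟨h, hn0⟩ := hn₀ n hn
  rwa [← sub_div, lt_div_iff₀ (by positivity)] at h
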